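/- Let G be a finite abelian group and F an algebraically closed field. Let ε be a generic G-graded contraction with support S := S(ε), and ε' any generic G-graded contraction, both regarded as points of F^{P_G}. Let the torus T_G = (F^×)^G act on F^{P_G} by (α·x)_{{g,h}} = α(g)α(h)α(gh)^{-1}·x_{{g,h}}, and for a generic contraction η let X(η) denote the Zariski closure of its T_G-orbit. For finitely supported m: S → ℕ write r(m) ∈ F_S for the product ∏_{i∈S} i^{m(i)} and η(m) := ∏_{i∈S} η(i)^{m(i)}. Then X(ε') ⊆ X(ε) if and only if S(ε') ⊆ S and ε'(m₁)·ε(m₂) = ε'(m₂)·ε(m₁) for all finitely supported m₁, m₂: S → ℕ with r(m₁)r(m₂)^{-1} ∈ ⟨R_G⟩ ∩ F_S. -/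

import Mathlib

/-!
STATEMENT 14: For a finite abelian group `G` and an algebraically closed field `F`, let
`ε` be a generic `G`-graded contraction with support `S := S(ε)` and `ε'` any generic
`G`-graded contraction, regarded as points of `F^{P_G}`.  Then the orbit closure
`X(ε')` is contained in `X(ε)` if and only if `S(ε') ⊆ S` and
`ε'(m₁)·ε(m₂) = ε'(m₂)·ε(m₁)` for all finitely supported `m₁, m₂ : S → ℕ` with
`r(m₁)r(m₂)⁻¹ ∈ ⟨R_G⟩ ∩ F_S`.
(`F_G` and its subgroups are written additively.)
-/

universe u v

open FreeAbelianGroup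

variable (G : Type u) [CommGroup G]

/-- The set of relators `{g,h}{gh,k}{h,k}⁻¹{g,hk}⁻¹` (written additively)
in the free abelian group `F_G` on the set of unordered pairs of elements of `G`. -/
def relatorSet : Set (FreeAbelianGroup (Sym2 G)) :=
  {r | ∃ g h k : G,
    r = of s(g, h) + of s(g * h, k) - of s(h, k) - of s(g, h * k)}

/-- The subgroup `⟨R_G⟩` of `F_G` generated by the relators. -/
def RG : AddSubgroup (FreeAbelianGroup (Sym2 G)) :=
  AddSubgroup.closure (relatorSet G)

variable {G}

/-- The subgroup `F_S` of `F_G` generated by `S ⊆ P_G`. -/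
def FS (S : Set (Sym2 G)) : AddSubgroup (FreeAbelianGroup (Sym2 G)) :=
  AddSubgroup.closure (of '' S)

/-- The element `r(m) = ∏ i^{m(i)}` of `F_G` (written additively) associated with a
finitely supported `m : P_G → ℕ`. -/
noncomputable def rOf (m : Sym2 G →₀ ℕ) : FreeAbelianGroup (Sym2 G) :=
  m.sum fun i n => n • of i

variable (G) (F : Type v) [Field F]

/-- The Zariski topology on the affine space `F^{P_G}`: closed sets are the common zero
sets of families of polynomials in the variables indexed by `P_G = Sym2 G`. -/
noncomputable instance zariskiTopology : TopologicalSpace (Sym2 G → F) :=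
  TopologicalSpace.ofClosed
    {C | ∃ P : Set (MvPolynomial (Sym2 G) F),
      C = {x | ∀ p ∈ P, MvPolynomial.eval x p = 0}}
    ⟨{1}, by ext x; simp⟩
    (fun A hA => by
      choose P hP using fun C (hC : C ∈ A) => hA hC
      refine ⟨⋃ (C) (hC : C ∈ A), P C hC, ?_⟩
      ext x
      simp only [Set.mem_sInter, Set.mem_setOf_eq, Set.mem_iUnion]
      constructor
      · rintro hx p ⟨C, hC, hp⟩
        have h := hx C hC
        rw [hP C hC] at h
        exact h p hp
      · intro hx C hC
        rw [hP C hC]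
        exact fun p hp => hx p ⟨C, hC, hp⟩)
    (fun A hA B hB => by
      obtain ⟨PA, rfl⟩ := hA
      obtain ⟨PB, rfl⟩ := hB
      refine ⟨{r | ∃ p ∈ PA, ∃ q ∈ PB, r = p * q}, ?_⟩
      ext x
      simp only [Set.mem_union, Set.mem_setOf_eq]
      constructor
      · rintro (hx | hx) r ⟨p, hp, q, hq, rfl⟩ <;> rw [map_mul]
        · rw [hx p hp, zero_mul]
        · rw [hx q hq, mul_zero]
      · intro hx
        by_contra hc
        push_neg at hc
        obtain ⟨⟨p, hp, hpx⟩, ⟨q, hq, hqx⟩⟩ := hc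
        have h := hx (p * q) ⟨p, hp, q, hq, rfl⟩
        rw [map_mul] at h
        rcases mul_eq_zero.mp h with h' | h'
        exacts [hpx h', hqx h'])

/-- The value of the coboundary `dα` at an unordered pair:
`dα({g,h}) = α(g)·α(h)·α(gh)⁻¹`. -/
noncomputable def dal (α : G → Fˣ) : Sym2 G → F :=
  Sym2.lift ⟨fun g h => ((α g * α h * (α (g * h))⁻¹ : Fˣ) : F),
    fun g h => by dsimp only; rw [mul_comm h g, mul_comm (α h) (α g)]⟩

variable {G F}

/-- The `T_G`-orbit of a point `η ∈ F^{P_G}` under the torus action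
`(α·x)_{{g,h}} = dα(g,h)·x_{{g,h}}`. -/
noncomputable def torusOrbit (η : Sym2 G → F) : Set (Sym2 G → F) :=
  {x | ∃ α : G → Fˣ, x = fun p => dal G F α p * η p}

/-- `η(m) = ∏ η(i)^{m(i)}`. -/
noncomputable def mpow (η : Sym2 G → F) (m : Sym2 G →₀ ℕ) : F :=
  m.prod fun i n => η i ^ n

theorem mem_closure_iff_forall_eval_eq_zero (A : Set (Sym2 G → F)) (x : Sym2 G → F) :
    x ∈ closure A ↔ ∀ p : MvPolynomial (Sym2 G) F,
      (∀ y ∈ A, MvPolynomial.eval y p = 0) → MvPolynomial.eval x p = 0 := by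
  have isClosed_iff : ∀ C : Set (Sym2 G → F), IsClosed C ↔
      ∃ P : Set (MvPolynomial (Sym2 G) F),
        C = {x | ∀ p ∈ P, MvPolynomial.eval x p = 0} := by
    intro C
    rw [← isOpen_compl_iff]
    change Cᶜᶜ ∈ {C | ∃ P : Set (MvPolynomial (Sym2 G) F),
      C = {x | ∀ p ∈ P, MvPolynomial.eval x p = 0}} ↔ _
    rw [compl_compl]
    rfl
  constructor
  · intro hx p hp
    have hC : IsClosed {x : Sym2 G → F | ∀ q ∈ ({p} : Set _), MvPolynomial.eval x q = 0} :=
      (isClosed_iff _).2 ⟨{p}, rfl⟩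
    have hA : A ⊆ {x : Sym2 G → F | ∀ q ∈ ({p} : Set _), MvPolynomial.eval x q = 0} := by
      rintro y hy q rfl
      exact hp y hy
    exact closure_minimal hA hC hx p rfl
  · intro h
    obtain ⟨P, hP⟩ := (isClosed_iff (closure A)).1 isClosed_closure
    rw [hP]
    intro p hp
    refine h p fun y hy => ?_
    have hy' := subset_closure hy
    rw [hP] at hy'
    exact hy' p hp

theorem cocycle_one_left {D : Type*} [AddCommGroup D] {f : G → G → D}
    (hcocycle : ∀ g h k, f g h + f (g * h) k = f h k + f g (h * k)) (g : G) :
    f 1 g = f 1 1 := by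
  have := hcocycle 1 1 g
  simp only [one_mul] at this
  exact (add_right_cancel this).symm

/-- The group law on `D × G` given by a symmetric 2-cocycle `f : G × G → D`. -/
@[reducible] def cocycleExtension {D : Type*} [AddCommGroup D] (f : G → G → D)
    (hsymm : ∀ g h, f g h = f h g)
    (hcocycle : ∀ g h k, f g h + f (g * h) k = f h k + f g (h * k)) :
    AddCommGroup (D × G) :=
  letI : Add (D × G) := ⟨fun x y => (x.1 + y.1 + f x.2 y.2, x.2 * y.2)⟩
  letI : Zero (D × G) := ⟨(-f 1 1, 1)⟩
  letI : Neg (D × G) := ⟨fun x => (-x.1 - f x.2⁻¹ x.2 - f 1 1, x.2⁻¹)⟩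
  have h_comm : ∀ x y : D × G, x + y = y + x := fun x y =>
    Prod.ext (by change x.1 + y.1 + f x.2 y.2 = y.1 + x.1 + f y.2 x.2
                 rw [hsymm, add_comm x.1]) (mul_comm _ _)
  have h_zero : ∀ x : D × G, 0 + x = x := fun x =>
    Prod.ext (by change -f 1 1 + x.1 + f 1 x.2 = x.1
                 rw [cocycle_one_left hcocycle x.2]; abel) (one_mul _)
  { add_assoc := fun x y z => Prod.ext
      (by change x.1 + y.1 + f x.2 y.2 + z.1 + f (x.2 * y.2) z.2 =
            x.1 + (y.1 + z.1 + f y.2 z.2) + f x.2 (y.2 * z.2)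
          have := hcocycle x.2 y.2 z.2
          rw [← sub_eq_zero] at this ⊢
          rw [← this]
          abel) (mul_assoc _ _ _)
    zero_add := h_zero
    add_zero := fun x => (h_comm x 0).trans (h_zero x)
    nsmul := nsmulRec
    zsmul := zsmulRec
    neg_add_cancel := fun x => Prod.ext
      (by change -x.1 - f x.2⁻¹ x.2 - f 1 1 + x.1 + f x.2⁻¹ x.2 = -f 1 1
          abel) (inv_mul_cancel _)
    add_comm := h_comm }

/-- A symmetric 2-cocycle with values in an injective abelian group is a coboundary. -/
theorem exists_eq_coboundary {D : Type*} [AddCommGroup D] (hD : Module.Baer ℤ D)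
    (f : G → G → D) (hsymm : ∀ g h, f g h = f h g)
    (hcocycle : ∀ g h k, f g h + f (g * h) k = f h k + f g (h * k)) :
    ∃ τ : G → D, ∀ g h, f g h = τ g + τ h - τ (g * h) := by
  let := cocycleExtension f hsymm hcocycle
  have add_def : ∀ x y : D × G, x + y = (x.1 + y.1 + f x.2 y.2, x.2 * y.2) :=
    fun _ _ => rfl
  let i : D →+ D × G := AddMonoidHom.mk' (fun d => (d - f 1 1, 1)) fun a b => by
    rw [add_def]
    exact Prod.ext (by dsimp only; abel) (one_mul _).symm
  have hi : Function.Injective i := fun a b hab => sub_left_injective (Prod.ext_iff.1 hab).1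
  obtain ⟨ρ, hρ⟩ := hD.extension_property_addMonoidHom i hi (AddMonoidHom.id D)
  refine ⟨fun g => ρ (0, g), fun g h => ?_⟩
  have key : i (f g h) + ((0, g * h) : D × G) = (0, g) + (0, h) := by
    rw [add_def, add_def]
    change ((f g h - f 1 1 + 0 + f 1 (g * h), 1 * (g * h)) : D × G) = (0 + 0 + f g h, g * h)
    rw [cocycle_one_left hcocycle (g * h), one_mul]
    exact Prod.ext (by dsimp only; abel) rfl
  rw [eq_sub_iff_add_eq, ← map_add, ← key, map_add]
  exact congrArg (· + _) (DFunLike.congr_fun hρ (f g h)).symm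

/-- The homomorphism `F_G → A` extending the coboundary `{g,h} ↦ τ(g) + τ(h) - τ(gh)`. -/
noncomputable def coboundaryHom {A : Type*} [AddCommGroup A] (τ : G → A) :
    FreeAbelianGroup (Sym2 G) →+ A :=
  FreeAbelianGroup.lift (Sym2.lift ⟨fun g h => τ g + τ h - τ (g * h),
    fun g h => by dsimp only; rw [mul_comm h g, add_comm (τ h)]⟩)

theorem coboundaryHom_of {A : Type*} [AddCommGroup A] (τ : G → A) (g h : G) :
    coboundaryHom τ (of s(g, h)) = τ g + τ h - τ (g * h) := by
  simp [coboundaryHom]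

theorem comp_coboundaryHom {A B : Type*} [AddCommGroup A] [AddCommGroup B] (φ : A →+ B)
    (τ : G → A) : φ.comp (coboundaryHom τ) = coboundaryHom (φ ∘ τ) := by
  refine FreeAbelianGroup.lift_ext _ _ fun p => ?_
  induction p with
  | h g h => simp [coboundaryHom_of]

theorem coboundaryHom_eq_zero_of_mem_RG {A : Type*} [AddCommGroup A] (τ : G → A)
    {x : FreeAbelianGroup (Sym2 G)} (hx : x ∈ RG G) : coboundaryHom τ x = 0 := by
  refine (AddSubgroup.closure_le (coboundaryHom τ).ker).2 ?_ hx
  rintro _ ⟨g, h, k, rfl⟩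
  simp only [SetLike.mem_coe, AddMonoidHom.mem_ker, map_add, map_sub, coboundaryHom_of,
    mul_assoc]
  abel

theorem mem_RG_of_forall_coboundaryHom_eq_zero {x : FreeAbelianGroup (Sym2 G)}
    (hx : ∀ τ : G → AddCircle (1 : ℚ), coboundaryHom τ x = 0) : x ∈ RG G := by
  rw [← QuotientAddGroup.eq_zero_iff]
  refine CharacterModule.eq_zero_of_character_apply fun c => ?_
  let c' : FreeAbelianGroup (Sym2 G) →+ AddCircle (1 : ℚ) :=
    AddMonoidHom.comp c (QuotientAddGroup.mk' (RG G))
  have hc' : ∀ y ∈ RG G, c' y = 0 := fun y hy => by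
    change c (QuotientAddGroup.mk y) = 0
    rw [(QuotientAddGroup.eq_zero_iff y).2 hy]
    exact map_zero c
  obtain ⟨τ, hτ⟩ := exists_eq_coboundary (Module.Baer.of_divisible _)
    (fun g h : G => c' (of s(g, h))) (fun g h => by rw [Sym2.eq_swap]) (fun g h k => by
      have := hc' _ (AddSubgroup.subset_closure ⟨g, h, k, rfl⟩)
      rw [sub_sub, map_sub, sub_eq_zero] at this
      simpa using this)
  have hcτ : c' = coboundaryHom τ := FreeAbelianGroup.lift_ext _ _ fun p => by
    induction p with
    | h g h => rw [coboundaryHom_of, ← hτ]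
  change c' x = 0
  rw [hcτ, hx]

theorem eq_zero_of_forall_units_zpow_eq_one {F : Type*} [Field F] [Infinite F] {k : ℤ}
    (hk : ∀ u : Fˣ, u ^ k = 1) : k = 0 := by
  by_contra hne
  have : NeZero k.natAbs := ⟨Int.natAbs_ne_zero.2 hne⟩
  have htop : ∀ u : Fˣ, u ∈ rootsOfUnity k.natAbs F := fun u => by
    rw [mem_rootsOfUnity, ← zpow_natCast]
    rcases Int.natAbs_eq k with h | h
    · rw [← h, hk]
    · rw [← inv_inj, ← zpow_neg, ← h, hk, inv_one]
  have : Finite Fˣ := Finite.of_injective (fun u => (⟨u, htop u⟩ : rootsOfUnity k.natAbs F))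
    fun _ _ h => congrArg Subtype.val h
  have : Finite F := Finite.of_finite_univ <|
    (((Set.finite_range ((↑) : Fˣ → F)).insert 0).subset fun x _ => by
      by_cases hx : x = 0
      · exact Or.inl hx
      · exact Or.inr ⟨Units.mk0 x hx, rfl⟩)
  exact not_finite F

/-- An element of `F_G` on which the coboundaries of all `α : G → Fˣ` vanish lies in `⟨R_G⟩`. -/
theorem mem_RG_of_forall_units [Infinite F] {x : FreeAbelianGroup (Sym2 G)}
    (hx : ∀ α : G → Additive Fˣ, coboundaryHom α x = 0) : x ∈ RG G := by
  classical
  let σ : G → G →₀ ℤ := fun g => Finsupp.single g 1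
  have hσ : coboundaryHom σ x = 0 := by
    ext g
    refine eq_zero_of_forall_units_zpow_eq_one (F := F) fun u => ?_
    have h := hx ((((zmultiplesHom (Additive Fˣ)) (Additive.ofMul u)).comp
      (Finsupp.applyAddHom g)) ∘ σ)
    rw [← comp_coboundaryHom] at h
    exact h
  refine mem_RG_of_forall_coboundaryHom_eq_zero fun τ => ?_
  have hτ : τ = (Finsupp.liftAddHom fun g => zmultiplesHom _ (τ g) :
      (G →₀ ℤ) →+ AddCircle (1 : ℚ)) ∘ σ := by
    funext g
    simp [σ]
  rw [hτ, ← comp_coboundaryHom, AddMonoidHom.comp_apply, hσ, map_zero]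

theorem rOf_mem_FS {S : Set (Sym2 G)} {m : Sym2 G →₀ ℕ} (hm : ↑m.support ⊆ S) :
    rOf m ∈ FS S :=
  sum_mem fun i hi =>
    nsmul_mem (AddSubgroup.subset_closure (Set.mem_image_of_mem of (hm hi))) _

theorem mpow_ne_zero {η : Sym2 G → F} {m : Sym2 G →₀ ℕ}
    (hm : ↑m.support ⊆ {p | η p ≠ 0}) : mpow η m ≠ 0 :=
  Finset.prod_ne_zero_iff.2 fun _ hi => pow_ne_zero _ (hm hi)

theorem mpow_eq_zero {η : Sym2 G → F} {m : Sym2 G →₀ ℕ}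
    (hm : ¬ ↑m.support ⊆ {p | η p ≠ 0}) : mpow η m = 0 := by
  obtain ⟨i, hi, hi'⟩ := Set.not_subset.1 hm
  have hi0 : η i = 0 := not_not.1 hi'
  exact Finset.prod_eq_zero hi (by simpa [hi0] using hi)

variable (F) in
/-- The character of `T_G` by which the torus acts on the monomial with exponent `m`. -/
noncomputable def monomialCharacter (m : Sym2 G →₀ ℕ) : (G → Fˣ) →* F where
  toFun α := mpow (dal G F α) m
  map_one' := by
    refine Finset.prod_eq_one fun p _ => ?_
    induction p with
    | h g h => simp [dal]
  map_mul' α β := by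
    simp only [mpow, Finsupp.prod, ← Finset.prod_mul_distrib]
    refine Finset.prod_congr rfl fun p _ => ?_
    rw [← mul_pow]
    congr 1
    induction p with
    | h g h =>
      simp only [dal, Sym2.lift_mk, Pi.mul_apply, ← Units.val_mul, mul_inv]
      congr 1
      exact (congrArg₂ (· * ·) (mul_mul_mul_comm _ _ _ _) rfl).trans (mul_mul_mul_comm _ _ _ _)

theorem monomialCharacter_apply (m : Sym2 G →₀ ℕ) (α : G → Fˣ) :
    monomialCharacter F m α =
      ((coboundaryHom (fun g => Additive.ofMul (α g)) (rOf m)).toMul : Fˣ) := by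
  simp only [rOf, Finsupp.sum, map_sum, map_nsmul, toMul_sum, toMul_nsmul, Units.coe_prod,
    Units.val_pow_eq_pow_val]
  refine Finset.prod_congr rfl fun p _ => ?_
  induction p with
  | h g h =>
    rw [coboundaryHom_of]
    simp [dal, div_eq_mul_inv]

theorem mpow_dal_mul (α : G → Fˣ) (η : Sym2 G → F) (m : Sym2 G →₀ ℕ) :
    mpow (fun p => dal G F α p * η p) m = monomialCharacter F m α * mpow η m := by
  change _ = mpow (dal G F α) m * mpow η m
  simp only [mpow, mul_pow, Finsupp.prod_mul]

theorem monomialCharacter_eq_iff [Infinite F] {m₁ m₂ : Sym2 G →₀ ℕ} :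
    monomialCharacter F m₁ = monomialCharacter F m₂ ↔ rOf m₁ - rOf m₂ ∈ RG G := by
  constructor
  · intro h
    refine mem_RG_of_forall_units (F := F) fun α => ?_
    have hα := DFunLike.congr_fun h fun g => (α g).toMul
    rw [monomialCharacter_apply, monomialCharacter_apply] at hα
    rw [map_sub, sub_eq_zero]
    exact Additive.toMul.injective (Units.ext hα)
  · intro h
    ext α
    have := coboundaryHom_eq_zero_of_mem_RG (fun g => Additive.ofMul (α g)) h
    rw [map_sub, sub_eq_zero] at this
    rw [monomialCharacter_apply, monomialCharacter_apply, this]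

theorem eval_dal_mul (p : MvPolynomial (Sym2 G) F) (α : G → Fˣ) (η : Sym2 G → F) :
    MvPolynomial.eval (fun i => dal G F α i * η i) p =
      ∑ m ∈ p.support, monomialCharacter F m α * (p.coeff m * mpow η m) := by
  rw [MvPolynomial.eval_eq]
  refine Finset.sum_congr rfl fun m _ => ?_
  rw [mul_left_comm, ← mpow_dal_mul]
  rfl

open scoped Classical in
theorem eval_dal_mul_eq_sum_characters (p : MvPolynomial (Sym2 G) F) (α : G → Fˣ)
    (η : Sym2 G → F) :
    MvPolynomial.eval (fun i => dal G F α i * η i) p =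
      ∑ χ ∈ p.support.image (monomialCharacter F),
        (∑ m ∈ p.support with monomialCharacter F m = χ, p.coeff m * mpow η m) * χ α := by
  rw [eval_dal_mul, ← Finset.sum_fiberwise_of_maps_to
    (fun m hm => Finset.mem_image_of_mem (monomialCharacter F) hm)]
  refine Finset.sum_congr rfl fun χ _ => ?_
  rw [Finset.sum_mul]
  refine Finset.sum_congr rfl fun m hm => ?_
  rw [(Finset.mem_filter.1 hm).2, mul_comm]

open scoped Classical in
/-- A polynomial vanishing on a torus orbit has all its isotypic components vanishing at
the base point. -/
theorem sum_coeff_mul_mpow_eq_zero {p : MvPolynomial (Sym2 G) F} {η : Sym2 G → F}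
    (hp : ∀ y ∈ torusOrbit η, MvPolynomial.eval y p = 0) {χ : (G → Fˣ) →* F}
    (hχ : χ ∈ p.support.image (monomialCharacter F)) :
    ∑ m ∈ p.support with monomialCharacter F m = χ, p.coeff m * mpow η m = 0 := by
  refine linearIndependent_iff'.1 (linearIndependent_monoidHom (G → Fˣ) F) _
    (fun χ => ∑ m ∈ p.support with monomialCharacter F m = χ, p.coeff m * mpow η m) ?_ χ hχ
  funext α
  rw [Finset.sum_apply]
  exact (eval_dal_mul_eq_sum_characters p α η).symm.trans (hp _ ⟨α, rfl⟩)

theorem mem_torusOrbit_self (η : Sym2 G → F) : η ∈ torusOrbit η := by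
  refine ⟨1, funext fun p => ?_⟩
  induction p with
  | h g h => simp [dal]

theorem closure_torusOrbit_subset_iff [Infinite F] (η η' : Sym2 G → F) :
    closure (torusOrbit η') ⊆ closure (torusOrbit η) ↔
      ({p : Sym2 G | η' p ≠ 0} ⊆ {p : Sym2 G | η p ≠ 0} ∧
        ∀ m₁ m₂ : Sym2 G →₀ ℕ, ↑m₁.support ⊆ {p : Sym2 G | η p ≠ 0} →
          ↑m₂.support ⊆ {p : Sym2 G | η p ≠ 0} →
          rOf m₁ - rOf m₂ ∈ RG G ⊓ FS {p : Sym2 G | η p ≠ 0} →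
          mpow η' m₁ * mpow η m₂ = mpow η' m₂ * mpow η m₁) := by
  classical
  constructor
  · intro h
    have hη' := (mem_closure_iff_forall_eval_eq_zero _ _).1
      (h (subset_closure (mem_torusOrbit_self η')))
    constructor
    · intro i hi hi0
      refine hi ?_
      have := hη' (MvPolynomial.X i) (by rintro _ ⟨α, rfl⟩; simp [hi0])
      simpa using this
    · intro m₁ m₂ _ _ hm
      have := hη' (MvPolynomial.monomial m₁ (mpow η m₂) - MvPolynomial.monomial m₂ (mpow η m₁))
        (by
          rintro _ ⟨α, rfl⟩
          rw [map_sub, MvPolynomial.eval_monomial, MvPolynomial.eval_monomial]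
          change mpow η m₂ * mpow _ m₁ - mpow η m₁ * mpow _ m₂ = 0
          rw [mpow_dal_mul, mpow_dal_mul, monomialCharacter_eq_iff.2 hm.1]
          ring)
      rw [map_sub, MvPolynomial.eval_monomial, MvPolynomial.eval_monomial, sub_eq_zero] at this
      rw [mul_comm, mul_comm (mpow η' m₂)]
      exact this
  · rintro ⟨hS, hm⟩
    refine closure_minimal ?_ isClosed_closure
    rintro _ ⟨α, rfl⟩
    refine (mem_closure_iff_forall_eval_eq_zero _ _).2 fun p hp => ?_
    rw [eval_dal_mul_eq_sum_characters]
    refine Finset.sum_eq_zero fun χ hχ => ?_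
    have hsum := sum_coeff_mul_mpow_eq_zero hp hχ
    suffices ∑ m ∈ p.support with monomialCharacter F m = χ, p.coeff m * mpow η' m = 0 by
      rw [this, zero_mul]
    have hzero : ∀ m : Sym2 G →₀ ℕ, ¬ ↑m.support ⊆ {p : Sym2 G | η p ≠ 0} →
        mpow η' m = 0 := fun m h => mpow_eq_zero fun h' => h (h'.trans hS)
    by_cases hex : ∃ m₀ : Sym2 G →₀ ℕ, monomialCharacter F m₀ = χ ∧
        ↑m₀.support ⊆ {p : Sym2 G | η p ≠ 0}
    · obtain ⟨m₀, rfl, hm₀⟩ := hex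
      refine (mul_eq_zero.1 ?_).resolve_right (mpow_ne_zero hm₀)
      rw [← zero_mul (mpow η' m₀), ← hsum, Finset.sum_mul, Finset.sum_mul]
      refine Finset.sum_congr rfl fun m hmem => ?_
      by_cases hms : ↑m.support ⊆ {p : Sym2 G | η p ≠ 0}
      · have := hm m m₀ hms hm₀ ⟨monomialCharacter_eq_iff.1 (Finset.mem_filter.1 hmem).2,
          (FS _).sub_mem (rOf_mem_FS hms) (rOf_mem_FS hm₀)⟩
        rw [mul_assoc, this, mul_assoc, mul_comm (mpow η' m₀)]
      · rw [hzero m hms, mpow_eq_zero hms]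
        ring
    · refine Finset.sum_eq_zero fun m hmem => ?_
      rw [hzero m fun h => hex ⟨m, (Finset.mem_filter.1 hmem).2, h⟩, mul_zero]

/-- Here `ε, ε'` are generic contractions (symmetric cocycle-like maps
`G × G → F`), regarded as the points `Sym2.lift ⟨ε, hsym⟩`, `Sym2.lift ⟨ε', hsym'⟩` of
`F^{P_G}`; `X(η)` is the Zariski closure of the torus orbit of `η`; the support of a
point is the set of unordered pairs where it does not vanish. -/
theorem orbit_closure_containment [Finite G] [IsAlgClosed F]
    (ε ε' : G → G → F)
    (hsym : ∀ g h : G, ε g h = ε h g)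
    (hcoc : ∀ g h k : G, ε g (h * k) * ε h k = ε k (g * h) * ε g h)
    (hsym' : ∀ g h : G, ε' g h = ε' h g)
    (hcoc' : ∀ g h k : G, ε' g (h * k) * ε' h k = ε' k (g * h) * ε' g h) :
    closure (torusOrbit (Sym2.lift ⟨ε', hsym'⟩)) ⊆
        closure (torusOrbit (Sym2.lift ⟨ε, hsym⟩)) ↔
      ({p : Sym2 G | Sym2.lift ⟨ε', hsym'⟩ p ≠ 0} ⊆
          {p : Sym2 G | Sym2.lift ⟨ε, hsym⟩ p ≠ 0} ∧
        ∀ m₁ m₂ : Sym2 G →₀ ℕ,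
          ↑m₁.support ⊆ {p : Sym2 G | Sym2.lift ⟨ε, hsym⟩ p ≠ 0} →
          ↑m₂.support ⊆ {p : Sym2 G | Sym2.lift ⟨ε, hsym⟩ p ≠ 0} →
          rOf m₁ - rOf m₂ ∈ RG G ⊓ FS {p : Sym2 G | Sym2.lift ⟨ε, hsym⟩ p ≠ 0} →
          mpow (Sym2.lift ⟨ε', hsym'⟩) m₁ * mpow (Sym2.lift ⟨ε, hsym⟩) m₂ =
            mpow (Sym2.lift ⟨ε', hsym'⟩) m₂ * mpow (Sym2.lift ⟨ε, hsym⟩) m₁) := by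
  have : Infinite F := IsAlgClosed.instInfinite
  exact closure_torusOrbit_subset_iff _ _
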